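/- arXiv:1610.01541 — 5 statements merged into one kernel-verified Lean document; each statement's English description precedes it below -/
import Mathlib

section
/- For all points a, b in ℝ³ with a ≠ b, the function x ↦ |x−a|⁻²·|x−b|⁻² is Lebesgue integrable on ℝ³ and ∫_{ℝ³} |x−a|⁻²|x−b|⁻² dx = π³/|a−b|. -/
open MeasureTheory Real

open Set Filter Topology in
/-- Feynman parametrisation of a product of two reciprocals. -/
lemma lintegral_feynman {A B : ℝ} (hA : 0 < A) (hB : 0 < B) :
    ∫⁻ t in Set.Ioi (0 : ℝ), ENNReal.ofReal (2 * t / (A + t ^ 2 * B) ^ 2)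
      = ENNReal.ofReal (A⁻¹ * B⁻¹) := by
  have hpos : ∀ t : ℝ, 0 < A + t ^ 2 * B := fun t => by positivity
  have hderiv : ∀ t : ℝ, HasDerivAt (fun t : ℝ => -(B⁻¹ * (A + t ^ 2 * B)⁻¹))
      (2 * t / (A + t ^ 2 * B) ^ 2) t := by
    intro t
    have h := ((((hasDerivAt_pow 2 t).mul_const B).const_add A).inv
      (hpos t).ne').const_mul B⁻¹ |>.neg
    refine h.congr_deriv ?_
    have := (hpos t).ne'
    field_simp
    simp [mul_comm]
  have hlim : Tendsto (fun t : ℝ => -(B⁻¹ * (A + t ^ 2 * B)⁻¹)) atTop (𝓝 0) := by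
    have h : Tendsto (fun t : ℝ => A + t ^ 2 * B) atTop atTop :=
      tendsto_atTop_add_const_left _ _
        ((tendsto_pow_atTop two_ne_zero).atTop_mul_const hB)
    simpa using (h.inv_tendsto_atTop.const_mul B⁻¹).neg
  have hnonneg : ∀ t ∈ Ioi (0 : ℝ), 0 ≤ 2 * t / (A + t ^ 2 * B) ^ 2 := fun t ht => by
    have : 0 < t := ht
    positivity
  have hint := integrableOn_Ioi_deriv_of_nonneg' (fun t _ => hderiv t) hnonneg hlim
  rw [← ofReal_integral_eq_lintegral_ofReal hint
    ((ae_restrict_iff' measurableSet_Ioi).2 (ae_of_all _ hnonneg)),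
    integral_Ioi_of_hasDerivAt_of_tendsto' (fun t _ => hderiv t) hint hlim]
  congr 1
  simp [mul_comm]

open Set Filter Topology in
/-- The radial profile of `(‖x‖ ^ 2 + m ^ 2) ^ (-2)` in dimension three. -/
lemma integral_radial_profile {m : ℝ} (hm : 0 < m) :
    IntegrableOn (fun r : ℝ => r ^ 2 * ((r ^ 2 + m ^ 2) ^ 2)⁻¹) (Ioi 0) ∧
      ∫ r in Ioi (0 : ℝ), r ^ 2 * ((r ^ 2 + m ^ 2) ^ 2)⁻¹ = π / (4 * m) := by
  have hderiv : ∀ r : ℝ, HasDerivAt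
      (fun r : ℝ => (2 * m)⁻¹ * arctan (r / m) - r / (r ^ 2 + m ^ 2) / 2)
      (r ^ 2 * ((r ^ 2 + m ^ 2) ^ 2)⁻¹) r := by
    intro r
    have hp : r ^ 2 + m ^ 2 ≠ 0 := by positivity
    have h := ((((hasDerivAt_id r).div_const m).arctan).const_mul (2 * m)⁻¹).sub
      (((hasDerivAt_id r).div ((hasDerivAt_pow 2 r).add_const (m ^ 2)) hp).div_const 2)
    refine h.congr_deriv ?_
    have hq : 1 + (r / m) ^ 2 = (r ^ 2 + m ^ 2) / m ^ 2 := by field_simp; ring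
    simp only [id_eq, hq]
    field_simp
    push_cast
    ring
  have hlim : Tendsto (fun r : ℝ => (2 * m)⁻¹ * arctan (r / m) - r / (r ^ 2 + m ^ 2) / 2)
      atTop (𝓝 (π / (4 * m))) := by
    have h1 : Tendsto (fun r : ℝ => arctan (r / m)) atTop (𝓝 (π / 2)) :=
      (tendsto_nhds_of_tendsto_nhdsWithin tendsto_arctan_atTop).comp
        (tendsto_id.atTop_div_const hm)
    have h2 : Tendsto (fun r : ℝ => r / (r ^ 2 + m ^ 2)) atTop (𝓝 0) := by
      refine squeeze_zero' ?_ ?_ tendsto_inv_atTop_zero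
      · filter_upwards [eventually_gt_atTop 0] with r hr
        positivity
      · filter_upwards [eventually_gt_atTop 0] with r hr
        rw [div_le_iff₀ (by positivity)]
        have : r⁻¹ * (r ^ 2 + m ^ 2) = r + m ^ 2 / r := by field_simp
        rw [this]
        have : 0 ≤ m ^ 2 / r := by positivity
        linarith
    convert (h1.const_mul (2 * m)⁻¹).sub (h2.div_const 2) using 2
    field_simp
    ring
  have hint := integrableOn_Ioi_deriv_of_nonneg' (a := 0) (fun r _ => hderiv r)
    (fun r _ => by positivity) hlim
  refine ⟨hint, ?_⟩
  rw [integral_Ioi_of_hasDerivAt_of_tendsto' (fun r _ => hderiv r) hint hlim]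
  simp

lemma lintegral_inv_sq_norm_add_sq {m : ℝ} (hm : 0 < m) :
    ∫⁻ x : EuclideanSpace ℝ (Fin 3), ENNReal.ofReal ((‖x‖ ^ 2 + m ^ 2) ^ 2)⁻¹
      = ENNReal.ofReal (π ^ 2 / m) := by
  obtain ⟨hint, hval⟩ := integral_radial_profile hm
  have hI : Integrable (fun x : EuclideanSpace ℝ (Fin 3) => ((‖x‖ ^ 2 + m ^ 2) ^ 2)⁻¹) := by
    rw [integrable_fun_norm_addHaar volume (f := fun r : ℝ => ((r ^ 2 + m ^ 2) ^ 2)⁻¹)]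
    simpa using hint
  rw [← ofReal_integral_eq_lintegral_ofReal hI (ae_of_all _ fun x => by positivity),
    integral_fun_norm_addHaar volume (fun r : ℝ => ((r ^ 2 + m ^ 2) ^ 2)⁻¹)]
  congr 1
  have hball : volume.real (Metric.ball (0 : EuclideanSpace ℝ (Fin 3)) 1) = π * 4 / 3 := by
    rw [Measure.real, EuclideanSpace.volume_ball_fin_three]
    simp
    positivity
  simp only [finrank_euclideanSpace, Fintype.card_fin, Nat.add_one_sub_one, smul_eq_mul,
    nsmul_eq_mul, hval, hball]
  push_cast
  field_simp

/-- Completing the square in a weighted sum of two squared distances. -/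
lemma norm_sub_sq_add_mul_norm_sub_sq {E : Type*} [NormedAddCommGroup E]
    [InnerProductSpace ℝ E] (x a b : E) {s : ℝ} (hs : 1 + s ≠ 0) :
    ‖x - a‖ ^ 2 + s * ‖x - b‖ ^ 2
      = (1 + s) * (‖x - (1 + s)⁻¹ • (a + s • b)‖ ^ 2 + s / (1 + s) ^ 2 * ‖a - b‖ ^ 2) := by
  simp only [← real_inner_self_eq_norm_sq, inner_sub_left, inner_sub_right, inner_add_left,
    inner_add_right, real_inner_smul_left, real_inner_smul_right, real_inner_comm x a,
    real_inner_comm x b, real_inner_comm a b]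
  field_simp
  ring

lemma lintegral_feynman_slice {a b : EuclideanSpace ℝ (Fin 3)} (hab : a ≠ b) {t : ℝ}
    (ht : 0 < t) :
    ∫⁻ x : EuclideanSpace ℝ (Fin 3),
        ENNReal.ofReal (2 * t / (‖x - a‖ ^ 2 + t ^ 2 * ‖x - b‖ ^ 2) ^ 2)
      = ENNReal.ofReal (2 * π ^ 2 / ‖a - b‖ * (1 + t ^ 2)⁻¹) := by
  have hd : 0 < ‖a - b‖ := norm_pos_iff.2 (sub_ne_zero.2 hab)
  have hm : 0 < t * ‖a - b‖ / (1 + t ^ 2) := by positivity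
  have hpt : ∀ x : EuclideanSpace ℝ (Fin 3),
      ENNReal.ofReal (2 * t / (‖x - a‖ ^ 2 + t ^ 2 * ‖x - b‖ ^ 2) ^ 2)
        = ENNReal.ofReal (2 * t / (1 + t ^ 2) ^ 2) *
          ENNReal.ofReal ((‖x - (1 + t ^ 2)⁻¹ • (a + t ^ 2 • b)‖ ^ 2
            + (t * ‖a - b‖ / (1 + t ^ 2)) ^ 2) ^ 2)⁻¹ := by
    intro x
    rw [← ENNReal.ofReal_mul (by positivity),
      norm_sub_sq_add_mul_norm_sub_sq x a b (s := t ^ 2) (by positivity),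
      div_pow (t * _), mul_pow t, mul_div_right_comm (t ^ 2), mul_pow, div_mul_eq_div_div,
      div_eq_mul_inv (2 * t / (1 + t ^ 2) ^ 2)]
  simp_rw [hpt]
  rw [lintegral_const_mul' _ _ ENNReal.ofReal_ne_top,
    lintegral_sub_right_eq_self (fun y : EuclideanSpace ℝ (Fin 3) =>
      ENNReal.ofReal ((‖y‖ ^ 2 + (t * ‖a - b‖ / (1 + t ^ 2)) ^ 2) ^ 2)⁻¹),
    lintegral_inv_sq_norm_add_sq hm, ← ENNReal.ofReal_mul (by positivity)]
  congr 1
  field_simp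

lemma lintegral_riesz_composition_inv_sq {a b : EuclideanSpace ℝ (Fin 3)} (hab : a ≠ b) :
    ∫⁻ x : EuclideanSpace ℝ (Fin 3), ENNReal.ofReal ((‖x - a‖ ^ 2)⁻¹ * (‖x - b‖ ^ 2)⁻¹)
      = ENNReal.ofReal (π ^ 3 / ‖a - b‖) := by
  calc
    _ = ∫⁻ x : EuclideanSpace ℝ (Fin 3), ∫⁻ t in Set.Ioi (0 : ℝ),
          ENNReal.ofReal (2 * t / (‖x - a‖ ^ 2 + t ^ 2 * ‖x - b‖ ^ 2) ^ 2) := by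
      refine lintegral_congr_ae ?_
      filter_upwards [Measure.ae_ne volume a, Measure.ae_ne volume b] with x hxa hxb
      have h1 := norm_pos_iff.2 (sub_ne_zero.2 hxa)
      have h2 := norm_pos_iff.2 (sub_ne_zero.2 hxb)
      exact (lintegral_feynman (by positivity) (by positivity)).symm
    _ = ∫⁻ t in Set.Ioi (0 : ℝ), ∫⁻ x : EuclideanSpace ℝ (Fin 3),
          ENNReal.ofReal (2 * t / (‖x - a‖ ^ 2 + t ^ 2 * ‖x - b‖ ^ 2) ^ 2) := by
      refine lintegral_lintegral_swap (Measurable.aemeasurable ?_)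
      unfold Function.uncurry
      fun_prop
    _ = ∫⁻ t in Set.Ioi (0 : ℝ), ENNReal.ofReal (2 * π ^ 2 / ‖a - b‖ * (1 + t ^ 2)⁻¹) :=
      setLIntegral_congr_fun measurableSet_Ioi fun t ht => lintegral_feynman_slice hab ht
    _ = ENNReal.ofReal (π ^ 3 / ‖a - b‖) := by
      rw [← ofReal_integral_eq_lintegral_ofReal
        (integrable_inv_one_add_sq.integrableOn.const_mul _)
        (ae_of_all _ fun t => by positivity), integral_const_mul, integral_Ioi_inv_one_add_sq]
      congr 1
      simp
      field_simp

/-- Riesz composition identity in dimension 3 with two inverse-square kernels: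
for `a ≠ b` in `ℝ³`, the function `x ↦ |x−a|⁻² |x−b|⁻²` is Lebesgue integrable on `ℝ³`
and its integral equals `π³ / |a−b|`. -/
theorem riesz_composition_inv_sq (a b : EuclideanSpace ℝ (Fin 3)) (hab : a ≠ b) :
    Integrable (fun x : EuclideanSpace ℝ (Fin 3) =>
      (‖x - a‖ ^ 2)⁻¹ * (‖x - b‖ ^ 2)⁻¹) ∧
    ∫ x : EuclideanSpace ℝ (Fin 3), (‖x - a‖ ^ 2)⁻¹ * (‖x - b‖ ^ 2)⁻¹
      = Real.pi ^ 3 / ‖a - b‖ := by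
  have hnonneg : 0 ≤ᵐ[volume] fun x : EuclideanSpace ℝ (Fin 3) =>
      (‖x - a‖ ^ 2)⁻¹ * (‖x - b‖ ^ 2)⁻¹ := ae_of_all _ fun x => by positivity
  have hmeas : AEStronglyMeasurable (fun x : EuclideanSpace ℝ (Fin 3) =>
      (‖x - a‖ ^ 2)⁻¹ * (‖x - b‖ ^ 2)⁻¹) volume :=
    Measurable.aestronglyMeasurable (by fun_prop)
  refine ⟨⟨hmeas, ?_⟩, ?_⟩
  · rw [hasFiniteIntegral_iff_ofReal hnonneg, lintegral_riesz_composition_inv_sq hab]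
    exact ENNReal.ofReal_lt_top
  · rw [integral_eq_lintegral_of_nonneg_ae hnonneg hmeas,
      lintegral_riesz_composition_inv_sq hab, ENNReal.toReal_ofReal (by positivity)]
end

section
/- Let τ ∈ (0,1), λ ∈ [2/3, 4/5], h > 0 and ρ₀ ≥ 6(1−λ)h. Set y = −h e₃ and w = −λ h e₃ in ℝ³. Then ∫_{{x ∈ ℝ³ : 6(1−λ)h ≤ |x| ≤ ρ₀}} |x|^τ · |x−y|⁻²|x−w|⁻² dx ≤ (5184 π/(1−τ)) · (6(1−λ)h)^{τ−1}. -/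
open MeasureTheory Real

lemma measurableSet_le_norm {E : Type*} [NormedAddCommGroup E] [MeasurableSpace E]
    [OpensMeasurableSpace E] (r : ℝ) : MeasurableSet {x : E | r ≤ ‖x‖} :=
  measurableSet_le measurable_const measurable_norm

lemma indicator_le_norm_rpow {E : Type*} [NormedAddCommGroup E] (r s : ℝ) :
    {x : E | r ≤ ‖x‖}.indicator (fun x ↦ ‖x‖ ^ s) =
      fun x ↦ (Set.Ici r).indicator (fun t : ℝ ↦ t ^ s) ‖x‖ := rfl

section PowerOutsideBall

open Module

variable {E : Type*} [NormedAddCommGroup E] [NormedSpace ℝ E] [FiniteDimensional ℝ E]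
  [Nontrivial E] [MeasurableSpace E] [BorelSpace E] (μ : Measure E) [μ.IsAddHaarMeasure]

/-- The radial density of `‖x‖ ^ s` outside a ball of radius `r`. -/
lemma pow_smul_indicator_rpow (d : ℕ) (hd : 1 ≤ d) {r : ℝ} (hr : 0 < r) (s : ℝ) :
    (fun t : ℝ ↦ t ^ (d - 1) • (Set.Ici r).indicator (fun t : ℝ ↦ t ^ s) t) =
      (Set.Ici r).indicator (fun t : ℝ ↦ t ^ (s + d - 1)) := by
  ext t
  by_cases ht : t ∈ Set.Ici r
  · have ht0 : 0 < t := hr.trans_le ht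
    simp only [Set.indicator_of_mem ht, smul_eq_mul]
    rw [← rpow_natCast, ← rpow_add ht0, Nat.cast_sub hd, Nat.cast_one]
    congr 1
    ring
  · simp [Set.indicator_of_notMem ht]

lemma integrableOn_norm_rpow_of_le_norm {r s : ℝ} (hr : 0 < r) (hs : s < -finrank ℝ E) :
    IntegrableOn (fun x : E ↦ ‖x‖ ^ s) {x | r ≤ ‖x‖} μ := by
  rw [← integrable_indicator_iff (measurableSet_le_norm r), indicator_le_norm_rpow,
    integrable_fun_norm_addHaar μ, pow_smul_indicator_rpow _ finrank_pos hr]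
  refine Integrable.integrableOn ?_
  rw [integrable_indicator_iff measurableSet_Ici, integrableOn_Ici_iff_integrableOn_Ioi]
  exact integrableOn_Ioi_rpow_of_lt (by linarith) hr

lemma setIntegral_norm_rpow_of_le_norm {r s : ℝ} (hr : 0 < r) (hs : s < -finrank ℝ E) :
    ∫ x in {x : E | r ≤ ‖x‖}, ‖x‖ ^ s ∂μ =
      finrank ℝ E * μ.real (Metric.ball 0 1) *
        (-r ^ (s + finrank ℝ E) / (s + finrank ℝ E)) := by
  have hIci : Set.Ioi 0 ∩ Set.Ici r = Set.Ici r :=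
    Set.inter_eq_right.2 fun t ht ↦ hr.trans_le ht
  rw [← integral_indicator (measurableSet_le_norm r), indicator_le_norm_rpow,
    integral_fun_norm_addHaar μ, pow_smul_indicator_rpow _ finrank_pos hr,
    setIntegral_indicator measurableSet_Ici, hIci, integral_Ici_eq_integral_Ioi,
    integral_Ioi_rpow_of_lt (by linarith) hr, sub_add_cancel, nsmul_eq_mul, smul_eq_mul,
    mul_assoc]

end PowerOutsideBall

lemma EuclideanSpace.volume_real_unit_ball_fin_three :
    volume.real (Metric.ball (0 : EuclideanSpace ℝ (Fin 3)) 1) = 4 * π / 3 := by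
  rw [Measure.real, EuclideanSpace.volume_ball_fin_three, ENNReal.ofReal_one, one_pow, one_mul,
    ENNReal.toReal_ofReal (by positivity), mul_comm]

lemma norm_div_six_le_norm_sub {E : Type*} [SeminormedAddCommGroup E] {x y : E}
    (hy : ‖y‖ ≤ 5 / 6 * ‖x‖) : ‖x‖ / 6 ≤ ‖x - y‖ := by
  linarith [norm_sub_norm_le x y]

lemma norm_rpow_mul_inv_sq_mul_inv_sq_le {E : Type*} [NormedAddCommGroup E] {x y w : E}
    (τ : ℝ) (hx : 0 < ‖x‖) (hy : ‖y‖ ≤ 5 / 6 * ‖x‖) (hw : ‖w‖ ≤ 5 / 6 * ‖x‖) :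
    ‖x‖ ^ τ * ((‖x - y‖ ^ 2)⁻¹ * (‖x - w‖ ^ 2)⁻¹) ≤ 6 ^ 4 * ‖x‖ ^ (τ - 4) := by
  have hxy := norm_div_six_le_norm_sub hy
  have hxw := norm_div_six_le_norm_sub hw
  calc ‖x‖ ^ τ * ((‖x - y‖ ^ 2)⁻¹ * (‖x - w‖ ^ 2)⁻¹)
      ≤ ‖x‖ ^ τ * (((‖x‖ / 6) ^ 2)⁻¹ * ((‖x‖ / 6) ^ 2)⁻¹) := by gcongr
    _ = 6 ^ 4 * ‖x‖ ^ (τ - 4) := by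
      rw [rpow_sub hx, show (4 : ℝ) = (4 : ℕ) by norm_num, rpow_natCast]
      field_simp

/-- Estimate for the integral `I₂″`: for `τ ∈ (0,1)`, `λ ∈ [2/3, 4/5]`, `h > 0`,
`ρ₀ ≥ 6(1−λ)h`, with `y = −h e₃` and `w = −λh e₃`,
`∫_{6(1−λ)h ≤ |x| ≤ ρ₀} |x|^τ |x−y|⁻² |x−w|⁻² dx ≤ (5184π/(1−τ)) (6(1−λ)h)^{τ−1}`. -/
theorem annulus_estimate (τ : ℝ) (hτ : τ ∈ Set.Ioo (0 : ℝ) 1)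
    (l : ℝ) (hl : l ∈ Set.Icc (2/3 : ℝ) (4/5))
    (h ρ₀ : ℝ) (hh : 0 < h) (hρ₀ : 6 * (1 - l) * h ≤ ρ₀) :
    ∫ x in {x : EuclideanSpace ℝ (Fin 3) | 6 * (1 - l) * h ≤ ‖x‖ ∧ ‖x‖ ≤ ρ₀},
        ‖x‖ ^ τ * ((‖x - (-(h • EuclideanSpace.single (2 : Fin 3) (1 : ℝ)))‖ ^ 2)⁻¹ *
                   (‖x - (-((l * h) • EuclideanSpace.single (2 : Fin 3) (1 : ℝ)))‖ ^ 2)⁻¹)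
      ≤ (5184 * Real.pi / (1 - τ)) * (6 * (1 - l) * h) ^ (τ - 1) := by
  obtain ⟨-, hτ1⟩ := hτ
  obtain ⟨hl0, hl1⟩ := hl
  set r := 6 * (1 - l) * h with hr_def
  have hhr : h ≤ 5 / 6 * r := by nlinarith
  have hlh : l * h ≤ h := by nlinarith
  have hr : 0 < r := by linarith
  have hdim : (Module.finrank ℝ (EuclideanSpace ℝ (Fin 3)) : ℝ) = 3 := by simp
  have hs : τ - 4 < -Module.finrank ℝ (EuclideanSpace ℝ (Fin 3)) := by
    rw [hdim]; linarith
  have hint := (integrableOn_norm_rpow_of_le_norm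
    (volume : Measure (EuclideanSpace ℝ (Fin 3))) hr hs).const_mul (6 ^ 4)
  have hsub : {x : EuclideanSpace ℝ (Fin 3) | r ≤ ‖x‖ ∧ ‖x‖ ≤ ρ₀} ⊆ {x | r ≤ ‖x‖} :=
    fun _ hx ↦ hx.1
  have hmeas : MeasurableSet {x : EuclideanSpace ℝ (Fin 3) | r ≤ ‖x‖ ∧ ‖x‖ ≤ ρ₀} :=
    (measurableSet_le_norm r).inter (measurableSet_le measurable_norm measurable_const)
  calc _ ≤ ∫ x in {x : EuclideanSpace ℝ (Fin 3) | r ≤ ‖x‖ ∧ ‖x‖ ≤ ρ₀},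
        6 ^ 4 * ‖x‖ ^ (τ - 4) := by
        refine integral_mono_of_nonneg (.of_forall fun x ↦ by positivity)
          (IntegrableOn.mono_set hint hsub) (ae_restrict_of_forall_mem hmeas fun x hx ↦ ?_)
        refine norm_rpow_mul_inv_sq_mul_inv_sq_le τ (hr.trans_le hx.1) ?_ ?_
        · rw [norm_neg, norm_smul, PiLp.norm_single, norm_one, mul_one,
            norm_of_nonneg hh.le]
          linarith [hx.1]
        · rw [norm_neg, norm_smul, PiLp.norm_single, norm_one, mul_one,
            norm_of_nonneg (by positivity)]
          linarith [hx.1]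
    _ ≤ ∫ x in {x : EuclideanSpace ℝ (Fin 3) | r ≤ ‖x‖}, 6 ^ 4 * ‖x‖ ^ (τ - 4) :=
        setIntegral_mono_set hint (.of_forall fun x ↦ by positivity) hsub.eventuallyLE
    _ = (5184 * Real.pi / (1 - τ)) * r ^ (τ - 1) := by
        have h1 : 1 - τ ≠ 0 := by linarith
        rw [integral_const_mul, setIntegral_norm_rpow_of_le_norm _ hr hs, hdim,
          EuclideanSpace.volume_real_unit_ball_fin_three, show τ - 4 + 3 = τ - 1 by ring,
          ← neg_sub 1 τ, neg_div_neg_eq]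
        field_simp
        norm_num
end

section
/- Let τ ∈ (0,1), M > 0, ρ₀ > 0, and let f : ℝ³ → ℝ be a measurable function satisfying |f(x)| ≤ M for all x ∈ ℝ³ and |f(x) − f(0)| ≤ (M/ρ₀^τ)|x|^τ for all x with |x| ≤ ρ₀. Then there exists a constant C > 0, depending only on τ and M, such that for every λ ∈ [2/3, 4/5] and every h with 0 < h ≤ ρ₀/2, setting y = −h e₃ and w = −λ h e₃, one has ∫_{ℝ³} |f(x) − f(0)| · |x−y|⁻²|x−w|⁻² dx ≤ (C/h)·((h/ρ₀)^τ + h/ρ₀). -/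
open MeasureTheory Real

/-- A radial function on `ℝ³`, integrable at the origin and at infinity, that dominates the
product of the two singular kernels. -/
noncomputable def radialMajorant (τ : ℝ) (u : EuclideanSpace ℝ (Fin 3)) : ℝ :=
  (‖u‖ ^ 2)⁻¹ * (1 + ‖u‖) ^ (τ - 2)

lemma radialMajorant_nonneg (τ : ℝ) (u : EuclideanSpace ℝ (Fin 3)) :
    0 ≤ radialMajorant τ u := by
  unfold radialMajorant
  positivity

lemma integrable_radialMajorant {τ : ℝ} (hτ : τ < 1) : Integrable (radialMajorant τ) := by
  have key := integrable_fun_norm_addHaar (E := EuclideanSpace ℝ (Fin 3)) volume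
    (f := fun r : ℝ => (r ^ 2)⁻¹ * (1 + r) ^ (τ - 2))
  refine key.mpr ?_
  have hint : IntegrableOn (fun r : ℝ => (r + 1) ^ (τ - 2)) (Set.Ioi 0) :=
    integrableOn_add_rpow_Ioi_of_lt (by linarith) (by norm_num)
  refine hint.congr_fun (fun r hr => ?_) measurableSet_Ioi
  have hr0 : r ≠ 0 := ne_of_gt hr
  simp only [finrank_euclideanSpace, Fintype.card_fin, smul_eq_mul, add_comm r 1, Nat.reduceSub]
  field_simp

/-- If the poles are at distance at least `1/5` from each other, the kernel of a pole is controlled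
by the sum of squared distances. -/
lemma rpow_div_add_sq_le {τ n a b : ℝ} (hτ : 0 ≤ τ) (hn : 0 ≤ n) (ha : 0 ≤ a) (hb : 0 ≤ b)
    (hna : n ≤ 1 + a) (hab : 1 / 5 ≤ a + b) :
    n ^ τ * (a ^ 2 + b ^ 2)⁻¹ ≤ 121 * (1 + a) ^ (τ - 2) := by
  have hsum : (1 + a) ^ 2 / 121 ≤ a ^ 2 + b ^ 2 := by
    rcases le_total (1 / 10) a with h | h <;> nlinarith
  calc n ^ τ * (a ^ 2 + b ^ 2)⁻¹ ≤ (1 + a) ^ τ * ((1 + a) ^ 2 / 121)⁻¹ := by gcongr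
    _ = 121 * (1 + a) ^ (τ - 2) := by
      rw [rpow_sub (by positivity), rpow_two]
      field_simp

lemma rpow_norm_mul_kernel_le {τ : ℝ} (hτ : 0 ≤ τ) {z p q : EuclideanSpace ℝ (Fin 3)}
    (hp : ‖p‖ ≤ 1) (hq : ‖q‖ ≤ 1) (hpq : 1 / 5 ≤ ‖p - q‖) :
    ‖z‖ ^ τ * ((‖z + p‖ ^ 2)⁻¹ * (‖z + q‖ ^ 2)⁻¹) ≤
      121 * (radialMajorant τ (z + p) + radialMajorant τ (z + q)) := by
  have hnp : ‖z‖ ≤ 1 + ‖z + p‖ := by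
    have := norm_sub_le (z + p) p
    rw [add_sub_cancel_right] at this
    linarith
  have hnq : ‖z‖ ≤ 1 + ‖z + q‖ := by
    have := norm_sub_le (z + q) q
    rw [add_sub_cancel_right] at this
    linarith
  have hsep : 1 / 5 ≤ ‖z + p‖ + ‖z + q‖ := by
    have := norm_sub_le (z + p) (z + q)
    rw [add_sub_add_left_eq_sub] at this
    linarith
  have hP := rpow_div_add_sq_le hτ (norm_nonneg z) (norm_nonneg _) (norm_nonneg _) hnp hsep
  have hQ := rpow_div_add_sq_le hτ (norm_nonneg z) (norm_nonneg _) (norm_nonneg _) hnq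
    (by rwa [add_comm] at hsep)
  unfold radialMajorant
  generalize ‖z + p‖ = a at *
  generalize ‖z + q‖ = b at *
  rw [add_comm (b ^ 2)] at hQ
  have hsplit : (a ^ 2)⁻¹ * (b ^ 2)⁻¹ ≤ (a ^ 2 + b ^ 2)⁻¹ * ((a ^ 2)⁻¹ + (b ^ 2)⁻¹) := by
    rcases eq_or_ne a 0 with rfl | ha
    · simp only [ne_eq, OfNat.ofNat_ne_zero, not_false_eq_true, zero_pow, inv_zero, zero_mul]
      positivity
    rcases eq_or_ne b 0 with rfl | hb
    · simp only [ne_eq, OfNat.ofNat_ne_zero, not_false_eq_true, zero_pow, inv_zero, mul_zero]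
      positivity
    apply le_of_eq
    field_simp
    ring
  calc ‖z‖ ^ τ * ((a ^ 2)⁻¹ * (b ^ 2)⁻¹)
      ≤ ‖z‖ ^ τ * ((a ^ 2 + b ^ 2)⁻¹ * ((a ^ 2)⁻¹ + (b ^ 2)⁻¹)) := by gcongr
    _ = (a ^ 2)⁻¹ * (‖z‖ ^ τ * (a ^ 2 + b ^ 2)⁻¹) +
          (b ^ 2)⁻¹ * (‖z‖ ^ τ * (a ^ 2 + b ^ 2)⁻¹) := by ring
    _ ≤ (a ^ 2)⁻¹ * (121 * (1 + a) ^ (τ - 2)) + (b ^ 2)⁻¹ * (121 * (1 + b) ^ (τ - 2)) := by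
      gcongr
    _ = _ := by ring

lemma integrable_radialMajorant_comp {τ : ℝ} (hτ : τ < 1) {h : ℝ} (hh : 0 < h)
    (p : EuclideanSpace ℝ (Fin 3)) : Integrable fun x => radialMajorant τ (h⁻¹ • x + p) :=
  ((integrable_radialMajorant hτ).comp_add_right p).comp_smul (inv_ne_zero hh.ne')

lemma integral_radialMajorant_comp (τ : ℝ) {h : ℝ} (hh : 0 < h) (p : EuclideanSpace ℝ (Fin 3)) :
    ∫ x, radialMajorant τ (h⁻¹ • x + p) = h ^ 3 * ∫ x, radialMajorant τ x := by
  rw [Measure.integral_comp_smul volume (fun x => radialMajorant τ (x + p)) h⁻¹,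
    integral_add_right_eq_self]
  simp [abs_of_pos hh]

/-- A bounded function that is Hölder continuous at the origin on a ball satisfies the Hölder
bound at the origin on the whole space. -/
lemma abs_sub_le_of_holder_of_bounded {E : Type*} [SeminormedAddCommGroup E] {f : E → ℝ}
    {τ M ρ : ℝ} (hτ : 0 ≤ τ) (hM : 0 ≤ M) (hρ : 0 < ρ) (hf : ∀ x, |f x| ≤ M)
    (hH : ∀ x, ‖x‖ ≤ ρ → |f x - f 0| ≤ M / ρ ^ τ * ‖x‖ ^ τ) (x : E) :
    |f x - f 0| ≤ 2 * M * (‖x‖ / ρ) ^ τ := by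
  rcases le_total ‖x‖ ρ with hx | hx
  · calc |f x - f 0| ≤ M / ρ ^ τ * ‖x‖ ^ τ := hH x hx
      _ = M * (‖x‖ / ρ) ^ τ := by rw [div_rpow (norm_nonneg x) hρ.le]; ring
      _ ≤ 2 * M * (‖x‖ / ρ) ^ τ := by gcongr; linarith
  · calc |f x - f 0| ≤ |f x| + |f 0| := abs_sub _ _
      _ ≤ 2 * M * 1 := by linarith [hf x, hf 0]
      _ ≤ 2 * M * (‖x‖ / ρ) ^ τ := by
        gcongr
        exact one_le_rpow ((one_le_div hρ).mpr hx) hτ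

/-- The analytic core of estimate (6.6): let `τ ∈ (0,1)` and `M > 0`. There is a
constant `C > 0`, depending only on `τ` and `M`, such that for all `ρ₀ > 0` and every
measurable `f : ℝ³ → ℝ` with `|f| ≤ M` everywhere and `|f(x) − f(0)| ≤ (M/ρ₀^τ)|x|^τ`
for `|x| ≤ ρ₀`, for every `λ ∈ [2/3, 4/5]` and every `0 < h ≤ ρ₀/2`, setting
`y = −h e₃`, `w = −λh e₃`, one has
`∫_{ℝ³} |f(x) − f(0)| |x−y|⁻² |x−w|⁻² dx ≤ (C/h)((h/ρ₀)^τ + h/ρ₀)`. -/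
theorem holder_term_estimate (τ M : ℝ) (hτ : τ ∈ Set.Ioo (0 : ℝ) 1) (hM : 0 < M) :
    ∃ C > 0, ∀ (ρ₀ : ℝ), 0 < ρ₀ →
      ∀ f : EuclideanSpace ℝ (Fin 3) → ℝ, Measurable f →
      (∀ x, |f x| ≤ M) →
      (∀ x : EuclideanSpace ℝ (Fin 3), ‖x‖ ≤ ρ₀ → |f x - f 0| ≤ M / ρ₀ ^ τ * ‖x‖ ^ τ) →
      ∀ l ∈ Set.Icc (2/3 : ℝ) (4/5), ∀ h : ℝ, 0 < h → h ≤ ρ₀ / 2 →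
      ∫ x : EuclideanSpace ℝ (Fin 3),
          |f x - f 0| * ((‖x - (-(h • EuclideanSpace.single (2 : Fin 3) (1 : ℝ)))‖ ^ 2)⁻¹ *
            (‖x - (-((l * h) • EuclideanSpace.single (2 : Fin 3) (1 : ℝ)))‖ ^ 2)⁻¹)
        ≤ C / h * ((h / ρ₀) ^ τ + h / ρ₀) := by
  obtain ⟨hτ0, hτ1⟩ := hτ
  set I := ∫ u, radialMajorant τ u with hI
  have hI0 : 0 ≤ I := integral_nonneg (radialMajorant_nonneg τ)
  refine ⟨484 * M * I + 1, by positivity, ?_⟩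
  intro ρ hρ f _ hfM hfH l hl h hh _
  obtain ⟨hl0, hl1⟩ := hl
  set e : EuclideanSpace ℝ (Fin 3) := EuclideanSpace.single (2 : Fin 3) (1 : ℝ)
  have he : ‖e‖ = 1 := by simp [e]
  have hle : ‖l • e‖ = l := by rw [norm_smul, he, norm_of_nonneg (by linarith), mul_one]
  have hsep : 1 / 5 ≤ ‖e - l • e‖ := by
    have := norm_sub_norm_le e (l • e)
    linarith
  have hpt : ∀ x, |f x - f 0| * ((‖x - (-(h • e))‖ ^ 2)⁻¹ * (‖x - (-((l * h) • e))‖ ^ 2)⁻¹) ≤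
      242 * M * (h / ρ) ^ τ * (h ^ 4)⁻¹ *
        (radialMajorant τ (h⁻¹ • x + e) + radialMajorant τ (h⁻¹ • x + l • e)) := by
    intro x
    obtain ⟨z, rfl⟩ : ∃ z, x = h • z := ⟨h⁻¹ • x, (smul_inv_smul₀ hh.ne' x).symm⟩
    have h1 : ‖h • z - (-(h • e))‖ = h * ‖z + e‖ := by
      rw [sub_neg_eq_add, ← smul_add, norm_smul, norm_of_nonneg hh.le]
    have h2 : ‖h • z - (-((l * h) • e))‖ = h * ‖z + l • e‖ := by
      rw [sub_neg_eq_add, mul_comm, mul_smul, ← smul_add, norm_smul, norm_of_nonneg hh.le]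
    have h3 : (‖h • z‖ / ρ) ^ τ = (h / ρ) ^ τ * ‖z‖ ^ τ := by
      rw [norm_smul, norm_of_nonneg hh.le, mul_div_right_comm,
        mul_rpow (by positivity) (norm_nonneg z)]
    have hF := abs_sub_le_of_holder_of_bounded hτ0.le hM.le hρ hfM hfH (h • z)
    rw [h3] at hF
    rw [h1, h2, inv_smul_smul₀ hh.ne']
    calc _ ≤ 2 * M * ((h / ρ) ^ τ * ‖z‖ ^ τ) *
          (((h * ‖z + e‖) ^ 2)⁻¹ * ((h * ‖z + l • e‖) ^ 2)⁻¹) := by gcongr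
      _ = 2 * M * (h / ρ) ^ τ * (h ^ 4)⁻¹ *
          (‖z‖ ^ τ * ((‖z + e‖ ^ 2)⁻¹ * (‖z + l • e‖ ^ 2)⁻¹)) := by
        simp only [mul_pow, mul_inv]
        ring
      _ ≤ 2 * M * (h / ρ) ^ τ * (h ^ 4)⁻¹ *
          (121 * (radialMajorant τ (z + e) + radialMajorant τ (z + l • e))) := by
        refine mul_le_mul_of_nonneg_left ?_ (by positivity)
        exact rpow_norm_mul_kernel_le hτ0.le he.le (by linarith) hsep
      _ = _ := by ring
  have hint := integrable_radialMajorant_comp hτ1 hh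
  calc _ ≤ ∫ x, 242 * M * (h / ρ) ^ τ * (h ^ 4)⁻¹ *
        (radialMajorant τ (h⁻¹ • x + e) + radialMajorant τ (h⁻¹ • x + l • e)) :=
      integral_mono_of_nonneg (.of_forall fun x => by positivity)
        (((hint e).add (hint (l • e))).const_mul _) (.of_forall hpt)
    _ = 484 * M * I / h * (h / ρ) ^ τ := by
      rw [integral_const_mul, integral_add (hint e) (hint (l • e)),
        integral_radialMajorant_comp τ hh, integral_radialMajorant_comp τ hh, ← hI]
      field_simp
      ring
    _ ≤ (484 * M * I + 1) / h * ((h / ρ) ^ τ + h / ρ) := by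
      gcongr
      · linarith
      · exact le_add_of_nonneg_right (by positivity)
end

section
/- Let M₀ > 0, α ∈ (0,1), t > 0 and λ ∈ ℝ. Write z = (z′, z₃) ∈ ℝ² × ℝ and set s = (3M₀)^{−1/(1+α)}. Then ∫_{F} [ (|z′|² + (z₃+1)²)(|z′|² + (z₃+λ)²) ]^{−1} dz ≤ (4π M₀ s^{α−1}/(1−α)) · t, where F = { z ∈ ℝ³ : |z′| ≥ s, |z₃| ≤ M₀ t |z′|^{1+α} }. -/
open MeasureTheory Real

/-- The radial function `|x|^p 1_{|x| ≥ s}` on the plane is integrable for `p < -2`. -/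
lemma integrable_indicator_norm_rpow_plane {s p : ℝ} (hs : 0 < s) (hp : p < -2) :
    Integrable (fun x : EuclideanSpace ℝ (Fin 2) =>
      (Set.Ici s).indicator (fun r : ℝ => r ^ p) ‖x‖) := by
  rw [integrable_fun_norm_addHaar volume (f := (Set.Ici s).indicator (fun r : ℝ => r ^ p))]
  have h : IntegrableOn (fun r : ℝ => r ^ (p + 1)) (Set.Ici s) := by
    rw [integrableOn_Ici_iff_integrableOn_Ioi]
    exact integrableOn_Ioi_rpow_of_lt (by linarith) hs
  refine ((integrable_indicator_iff measurableSet_Ici).2 h).integrableOn.congr_fun ?_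
    measurableSet_Ioi
  intro r hr
  by_cases hrs : r ∈ Set.Ici s
  · simp [Set.indicator_of_mem hrs, rpow_add_one (ne_of_gt hr), mul_comm]
  · simp [Set.indicator_of_notMem hrs]

lemma integral_indicator_norm_rpow_plane {s p : ℝ} (hs : 0 < s) (hp : p < -2) :
    ∫ x : EuclideanSpace ℝ (Fin 2), (Set.Ici s).indicator (fun r : ℝ => r ^ p) ‖x‖
      = 2 * π * (-s ^ (p + 2) / (p + 2)) := by
  rw [integral_fun_norm_addHaar volume ((Set.Ici s).indicator (fun r : ℝ => r ^ p))]
  have h : ∫ r in Set.Ioi (0 : ℝ), r ^ (Module.finrank ℝ (EuclideanSpace ℝ (Fin 2)) - 1) •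
      (Set.Ici s).indicator (fun r : ℝ => r ^ p) r = -s ^ (p + 2) / (p + 2) := by
    have h' : ∫ r in Set.Ioi (0 : ℝ), (Set.Ici s).indicator (fun r : ℝ => r ^ (p + 1)) r
        = -s ^ (p + 2) / (p + 2) := by
      rw [setIntegral_indicator measurableSet_Ici,
        Set.inter_eq_self_of_subset_right (Set.Ici_subset_Ioi.2 hs), integral_Ici_eq_integral_Ioi,
        integral_Ioi_rpow_of_lt (by linarith) hs]
      ring_nf
    rw [← h']
    refine setIntegral_congr_fun measurableSet_Ioi fun r hr => ?_
    by_cases hrs : r ∈ Set.Ici s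
    · simp [Set.indicator_of_mem hrs, rpow_add_one (ne_of_gt hr), mul_comm]
    · simp [Set.indicator_of_notMem hrs]
  rw [h]
  simp [Measure.real, EuclideanSpace.volume_ball_fin_two, pi_nonneg]
  ring

/-- The slab `{(x, y) : |x| ≥ s, |y| ≤ c |x|^q}` over the exterior of a disc is measurable. -/
lemma measurableSet_slab (s c q : ℝ) :
    MeasurableSet {z : EuclideanSpace ℝ (Fin 2) × ℝ | s ≤ ‖z.1‖ ∧ |z.2| ≤ c * ‖z.1‖ ^ q} := by
  rw [Set.ofPred_and]
  apply MeasurableSet.inter <;> apply measurableSet_le <;> fun_prop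

lemma slab_indicator_section {s c q : ℝ} (x : EuclideanSpace ℝ (Fin 2)) :
    (fun y : ℝ => {z : EuclideanSpace ℝ (Fin 2) × ℝ | s ≤ ‖z.1‖ ∧ |z.2| ≤ c * ‖z.1‖ ^ q}.indicator
        (fun z => (‖z.1‖ ^ 4)⁻¹) (x, y)) =
      (Set.Icc (-(c * ‖x‖ ^ q)) (c * ‖x‖ ^ q)).indicator
        (fun _ => (Set.Ici s).indicator (fun r : ℝ => (r ^ 4)⁻¹) ‖x‖) := by
  ext y
  by_cases h₁ : s ≤ ‖x‖ <;> by_cases h₂ : |y| ≤ c * ‖x‖ ^ q <;>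
    simp [Set.indicator, h₁, h₂, ← abs_le]

lemma integral_slab_indicator_section {s c q : ℝ} (hs : 0 < s) (hc : 0 ≤ c)
    (x : EuclideanSpace ℝ (Fin 2)) :
    ∫ y : ℝ, {z : EuclideanSpace ℝ (Fin 2) × ℝ | s ≤ ‖z.1‖ ∧ |z.2| ≤ c * ‖z.1‖ ^ q}.indicator
        (fun z => (‖z.1‖ ^ 4)⁻¹) (x, y) =
      2 * c * (Set.Ici s).indicator (fun r : ℝ => r ^ (q - 4)) ‖x‖ := by
  rw [slab_indicator_section, integral_indicator measurableSet_Icc, setIntegral_const,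
    Real.volume_real_Icc_of_le (neg_le_self (by positivity))]
  by_cases h : s ≤ ‖x‖
  · have hx : 0 < ‖x‖ := hs.trans_le h
    have h4 : ‖x‖ ^ (q - 4) = ‖x‖ ^ q * (‖x‖ ^ 4)⁻¹ := by
      rw [rpow_sub hx, div_eq_mul_inv]
      norm_cast
    simp only [Set.indicator, Set.mem_Ici, h, if_true, smul_eq_mul, h4]
    ring
  · simp [Set.indicator, h]

lemma integrable_slab_indicator {s c q : ℝ} (hs : 0 < s) (hc : 0 ≤ c) (hq : q < 2) :
    Integrable ({z : EuclideanSpace ℝ (Fin 2) × ℝ | s ≤ ‖z.1‖ ∧ |z.2| ≤ c * ‖z.1‖ ^ q}.indicator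
      (fun z => (‖z.1‖ ^ 4)⁻¹)) := by
  have hmeas : Measurable
      ({z : EuclideanSpace ℝ (Fin 2) × ℝ | s ≤ ‖z.1‖ ∧ |z.2| ≤ c * ‖z.1‖ ^ q}.indicator
        (fun z => (‖z.1‖ ^ 4)⁻¹)) :=
    Measurable.indicator (by fun_prop) (measurableSet_slab s c q)
  rw [Measure.volume_eq_prod, integrable_prod_iff hmeas.aestronglyMeasurable]
  refine ⟨.of_forall fun x => ?_, ?_⟩
  · rw [slab_indicator_section]
    exact (integrable_indicator_iff measurableSet_Icc).2 (integrableOn_const (by simp))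
  · have hnn : ∀ z, 0 ≤ {z : EuclideanSpace ℝ (Fin 2) × ℝ |
        s ≤ ‖z.1‖ ∧ |z.2| ≤ c * ‖z.1‖ ^ q}.indicator (fun z => (‖z.1‖ ^ 4)⁻¹) z :=
      fun z => Set.indicator_nonneg (fun _ _ => by positivity) z
    simp only [Real.norm_of_nonneg (hnn _), integral_slab_indicator_section hs hc]
    exact (integrable_indicator_norm_rpow_plane hs (by linarith)).const_mul _

lemma setIntegral_slab_inv_norm_pow_four {s c q : ℝ} (hs : 0 < s) (hc : 0 ≤ c) (hq : q < 2) :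
    ∫ z in {z : EuclideanSpace ℝ (Fin 2) × ℝ | s ≤ ‖z.1‖ ∧ |z.2| ≤ c * ‖z.1‖ ^ q},
        (‖z.1‖ ^ 4)⁻¹ = 4 * π * c * s ^ (q - 2) / (2 - q) := by
  rw [← integral_indicator (measurableSet_slab s c q), Measure.volume_eq_prod,
    integral_prod _ (integrable_slab_indicator hs hc hq)]
  simp only [integral_slab_indicator_section hs hc]
  rw [integral_const_mul, integral_indicator_norm_rpow_plane hs (by linarith),
    show q - 4 + 2 = -(2 - q) by ring, show q - 2 = -(2 - q) by ring, neg_div_neg_eq]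
  ring

/-- Estimate for the integral `J₂`: for `M₀ > 0`, `α ∈ (0,1)`, `t > 0`, `λ ∈ ℝ`, with
`s = (3M₀)^{−1/(1+α)}`,
`∫_{F} [(|z′|² + (z₃+1)²)(|z′|² + (z₃+λ)²)]⁻¹ dz ≤ (4π M₀ s^{α−1}/(1−α)) t`, where
`F = {z = (z′,z₃) : |z′| ≥ s, |z₃| ≤ M₀ t |z′|^{1+α}}`. -/
theorem slab_outer_estimate (M₀ : ℝ) (hM₀ : 0 < M₀) (α : ℝ) (hα : α ∈ Set.Ioo (0 : ℝ) 1)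
    (t : ℝ) (ht : 0 < t) (l : ℝ) :
    ∫ z in {z : EuclideanSpace ℝ (Fin 2) × ℝ |
          (3 * M₀) ^ (-(1 / (1 + α))) ≤ ‖z.1‖ ∧ |z.2| ≤ M₀ * t * ‖z.1‖ ^ (1 + α)},
        ((‖z.1‖ ^ 2 + (z.2 + 1) ^ 2) * (‖z.1‖ ^ 2 + (z.2 + l) ^ 2))⁻¹
      ≤ (4 * Real.pi * M₀ * ((3 * M₀) ^ (-(1 / (1 + α)))) ^ (α - 1) / (1 - α)) * t := by
  have hs : 0 < (3 * M₀) ^ (-(1 / (1 + α))) := by positivity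
  have hc : 0 ≤ M₀ * t := by positivity
  have hq : 1 + α < 2 := by linarith [hα.2]
  generalize (3 * M₀) ^ (-(1 / (1 + α))) = s at hs ⊢
  calc
    _ ≤ ∫ z in {z : EuclideanSpace ℝ (Fin 2) × ℝ |
          s ≤ ‖z.1‖ ∧ |z.2| ≤ M₀ * t * ‖z.1‖ ^ (1 + α)}, (‖z.1‖ ^ 4)⁻¹ := by
      refine integral_mono_of_nonneg (.of_forall fun z => by positivity)
        ((integrable_indicator_iff (measurableSet_slab s _ _)).1
          (integrable_slab_indicator hs hc hq)) ?_
      filter_upwards [ae_restrict_mem (measurableSet_slab s _ _)] with z hz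
      have hz₁ : 0 < ‖z.1‖ := hs.trans_le hz.1
      refine inv_anti₀ (by positivity) ?_
      calc ‖z.1‖ ^ 4 = ‖z.1‖ ^ 2 * ‖z.1‖ ^ 2 := by ring
        _ ≤ _ := by
          gcongr <;> exact le_add_of_nonneg_right (sq_nonneg _)
    _ = _ := by
      rw [setIntegral_slab_inv_norm_pow_four hs hc hq, show 1 + α - 2 = α - 1 by ring,
        show 2 - (1 + α) = 1 - α by ring]
      ring
end

section
/- Let M₀ > 0, α ∈ (0,1), λ ∈ [2/3, 4/5], ρ₀ > 0 and let h satisfy 0 < h ≤ ρ₀/(2√(1+M₀²)). Set y = −h e₃ and w = −λ h e₃, and let B = { x = (x′, x₃) ∈ ℝ³ : |x′| ≤ ρ₀/√(1+M₀²), |x₃| ≤ (M₀/ρ₀^α)|x′|^{1+α} }. Then there exists a constant C > 0, depending only on M₀ and α, such that ∫_{B} |x−y|⁻²|x−w|⁻² dx ≤ (C/h)·(h/ρ₀)^α. -/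
open MeasureTheory Real

/-- The Lebesgue integral over the region `|t| ≤ A z` of a function not depending on `t`. -/
theorem setLIntegral_abs_fst_le {E : Type*} [MeasurableSpace E] (μ : Measure E) [SFinite μ]
    {A c : E → ℝ} (hA : Measurable A) (hc : Measurable c) (hA0 : ∀ z, 0 ≤ A z) :
    ∫⁻ p in {p : ℝ × E | |p.1| ≤ A p.2}, ENNReal.ofReal (c p.2) ∂((volume : Measure ℝ).prod μ) =
      ∫⁻ z, ENNReal.ofReal (2 * A z * c z) ∂μ := by
  have hS : MeasurableSet {p : ℝ × E | |p.1| ≤ A p.2} :=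
    measurableSet_le (by fun_prop) (by fun_prop)
  rw [← lintegral_indicator hS, lintegral_prod_symm _
    (Measurable.indicator (by fun_prop) hS).aemeasurable]
  refine lintegral_congr fun z => ?_
  have hind : ∀ t : ℝ, {p : ℝ × E | |p.1| ≤ A p.2}.indicator
      (fun p => ENNReal.ofReal (c p.2)) (t, z) =
      (Set.Icc (-A z) (A z)).indicator (fun _ => ENNReal.ofReal (c z)) t := fun t => by
    simp only [Set.indicator, Set.mem_ofPred_eq, Set.mem_Icc, abs_le]
  simp_rw [hind]
  rw [lintegral_indicator measurableSet_Icc, setLIntegral_const, Real.volume_Icc, mul_comm,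
    ← ENNReal.ofReal_mul (by linarith [hA0 z])]
  ring_nf

theorem norm_add_rpow_neg_eq_smul {E : Type*} [NormedAddCommGroup E] [NormedSpace ℝ E]
    {h s : ℝ} (hh : 0 < h) (z : E) :
    (‖z‖ + h) ^ (-s) = h ^ (-s) * (1 + ‖h⁻¹ • z‖) ^ (-s) := by
  rw [← Real.mul_rpow hh.le (by positivity), norm_smul, Real.norm_of_nonneg (by positivity)]
  congr 1
  field_simp
  ring

section Scaling

variable {E : Type*} [NormedAddCommGroup E] [NormedSpace ℝ E] [FiniteDimensional ℝ E]
  [MeasurableSpace E] [BorelSpace E] (μ : Measure E) [μ.IsAddHaarMeasure]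

theorem integrable_norm_add_rpow_neg {h s : ℝ} (hh : 0 < h)
    (hs : (Module.finrank ℝ E : ℝ) < s) : Integrable (fun z : E => (‖z‖ + h) ^ (-s)) μ := by
  simp_rw [norm_add_rpow_neg_eq_smul hh]
  exact ((integrable_one_add_norm hs).comp_smul (inv_ne_zero hh.ne')).const_mul _

theorem integral_norm_add_rpow_neg {h s : ℝ} (hh : 0 < h) :
    ∫ z : E, (‖z‖ + h) ^ (-s) ∂μ =
      h ^ ((Module.finrank ℝ E : ℝ) - s) * ∫ z : E, (1 + ‖z‖) ^ (-s) ∂μ := by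
  simp_rw [norm_add_rpow_neg_eq_smul hh]
  rw [integral_const_mul,
    Measure.integral_comp_inv_smul_of_nonneg μ (fun z : E => (1 + ‖z‖) ^ (-s)) hh.le,
    smul_eq_mul, ← mul_assoc, ← Real.rpow_natCast, ← Real.rpow_add hh]
  congr 2
  ring

end Scaling

/-- In the cone `|t| ≤ M r`, the squared distance from `(r, t)` to `(0, -k)` controls
`(r + h)²` whenever `k` is comparable with `h`. -/
theorem sq_add_le_of_abs_le_mul {M r t h k : ℝ} (hh : 0 < h)
    (ht : |t| ≤ M * r) (hk : 2 / 3 * h ≤ k) :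
    (r + h) ^ 2 ≤ 5 * (2 + M ^ 2) * (r ^ 2 + (t + k) ^ 2) := by
  have hkb : k ≤ |t + k| + M * r := by
    linarith [le_abs_self (t + k), neg_abs_le t]
  have hk2 : k ^ 2 ≤ (|t + k| + M * r) ^ 2 := by
    gcongr
    linarith
  have hcs : (|t + k| + M * r) ^ 2 ≤ (1 + M ^ 2) * (r ^ 2 + (t + k) ^ 2) := by
    nlinarith [sq_nonneg (M * |t + k| - r), sq_abs (t + k)]
  have hh2 : h ^ 2 ≤ 9 / 4 * k ^ 2 := by nlinarith
  nlinarith [sq_nonneg (r - h), sq_nonneg (t + k), sq_nonneg M, sq_nonneg r,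
    mul_nonneg (sq_nonneg M) (sq_nonneg r), mul_nonneg (sq_nonneg M) (sq_nonneg (t + k))]

/-- The splitting of `ℝ³` into its last coordinate and its first two. -/
noncomputable def lastCoordEquiv : EuclideanSpace ℝ (Fin 3) ≃ᵐ ℝ × (Fin 2 → ℝ) :=
  (MeasurableEquiv.toLp 2 (Fin 3 → ℝ)).symm.trans
    (MeasurableEquiv.piFinSuccAbove (fun _ : Fin 3 => ℝ) 2)

theorem measurePreserving_lastCoordEquiv : MeasurePreserving lastCoordEquiv :=
  (volume_preserving_piFinSuccAbove (fun _ : Fin 3 => ℝ) 2).comp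
    (EuclideanSpace.volume_preserving_symm_measurableEquiv_toLp (Fin 3))

theorem lastCoordEquiv_snd_zero (x : EuclideanSpace ℝ (Fin 3)) :
    (lastCoordEquiv x).2 0 = x 0 := rfl

theorem lastCoordEquiv_snd_one (x : EuclideanSpace ℝ (Fin 3)) :
    (lastCoordEquiv x).2 1 = x 1 := rfl

theorem norm_sub_neg_smul_single_sq (x : EuclideanSpace ℝ (Fin 3)) (k : ℝ) :
    ‖x - (-(k • EuclideanSpace.single (2 : Fin 3) (1 : ℝ)))‖ ^ 2 =
      √(x 0 ^ 2 + x 1 ^ 2) ^ 2 + (x 2 + k) ^ 2 := by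
  rw [Real.sq_sqrt (by positivity), EuclideanSpace.norm_sq_eq, Fin.sum_univ_three]
  simp [sq_abs]

theorem norm_le_sqrt_sq_add_sq (z : Fin 2 → ℝ) : ‖z‖ ≤ √(z 0 ^ 2 + z 1 ^ 2) := by
  refine (pi_norm_le_iff_of_nonneg (Real.sqrt_nonneg _)).2 fun i => ?_
  refine Real.abs_le_sqrt ?_
  fin_cases i
  · simpa using sq_nonneg (z 1)
  · simpa using sq_nonneg (z 0)

/-- The graph bound `|t| ≤ (M / ρ^α) r^{1+α}` implies the cone bound `|t| ≤ M r` for `r ≤ ρ`. -/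
theorem div_rpow_mul_rpow_one_add_le {M r ρ α : ℝ} (hM : 0 ≤ M) (hr : 0 ≤ r) (hρ : 0 < ρ)
    (hrρ : r ≤ ρ) (hα : 0 < α) : M / ρ ^ α * r ^ (1 + α) ≤ M * r := by
  have h1 : r ^ α ≤ ρ ^ α := Real.rpow_le_rpow hr hrρ hα.le
  have h2 : 0 < ρ ^ α := Real.rpow_pos_of_pos hρ α
  rw [Real.rpow_one_add' hr (by positivity), div_mul_eq_mul_div, div_le_iff₀ h2]
  nlinarith [mul_le_mul_of_nonneg_left h1 (mul_nonneg hM hr)]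

theorem rpow_mul_inv_pow_le {n r h α : ℝ} (hn : 0 ≤ n) (hnr : n ≤ r) (hh : 0 < h)
    (hα0 : 0 < α) (hα1 : α < 1) :
    r ^ (1 + α) * ((r + h) ^ 4)⁻¹ ≤ (n + h) ^ (-(3 - α)) := by
  have hr : 0 ≤ r := hn.trans hnr
  have hrh : 0 < r + h := by positivity
  calc r ^ (1 + α) * ((r + h) ^ 4)⁻¹
      ≤ (r + h) ^ (1 + α) * ((r + h) ^ 4)⁻¹ := by
        gcongr
        linarith
    _ = (r + h) ^ (-(3 - α)) := by
        rw [← Real.rpow_natCast, ← Real.rpow_neg hrh.le, ← Real.rpow_add hrh]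
        congr 1
        push_cast
        ring
    _ ≤ (n + h) ^ (-(3 - α)) :=
        Real.rpow_le_rpow_of_nonpos (by positivity) (by linarith) (by linarith)

/-- Key estimate for the term `(Γ₀⁺ − Γ₀^{D₁})(y_h, w_h)`: for `M₀ > 0`, `α ∈ (0,1)`,
there is `C > 0` depending only on `M₀` and `α` such that for all `λ ∈ [2/3, 4/5]`,
`ρ₀ > 0` and all `h` with `0 < h ≤ ρ₀/(2√(1+M₀²))`, setting `y = −h e₃`, `w = −λh e₃` and
`B = {x = (x′,x₃) : |x′| ≤ ρ₀/√(1+M₀²), |x₃| ≤ (M₀/ρ₀^α)|x′|^{1+α}}`, one has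
`∫_B |x−y|⁻² |x−w|⁻² dx ≤ (C/h)(h/ρ₀)^α`. -/
theorem graph_neighbourhood_estimate (M₀ : ℝ) (hM₀ : 0 < M₀) (α : ℝ)
    (hα : α ∈ Set.Ioo (0 : ℝ) 1) :
    ∃ C > 0, ∀ l ∈ Set.Icc (2/3 : ℝ) (4/5), ∀ ρ₀ : ℝ, 0 < ρ₀ →
      ∀ h : ℝ, 0 < h → h ≤ ρ₀ / (2 * Real.sqrt (1 + M₀ ^ 2)) →
      ∫ x in {x : EuclideanSpace ℝ (Fin 3) |
            Real.sqrt ((x 0) ^ 2 + (x 1) ^ 2) ≤ ρ₀ / Real.sqrt (1 + M₀ ^ 2) ∧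
            |x 2| ≤ M₀ / ρ₀ ^ α * (Real.sqrt ((x 0) ^ 2 + (x 1) ^ 2)) ^ (1 + α)},
          (‖x - (-(h • EuclideanSpace.single (2 : Fin 3) (1 : ℝ)))‖ ^ 2)⁻¹ *
          (‖x - (-((l * h) • EuclideanSpace.single (2 : Fin 3) (1 : ℝ)))‖ ^ 2)⁻¹
        ≤ C / h * (h / ρ₀) ^ α := by
  obtain ⟨hα0, hα1⟩ := hα
  set K : ℝ := 5 * (2 + M₀ ^ 2)
  have hK0 : 0 < K := by positivity
  set I : ℝ := ∫ z : Fin 2 → ℝ, (1 + ‖z‖) ^ (-(3 - α))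
  have hI0 : 0 ≤ I := integral_nonneg fun z => by positivity
  refine ⟨2 * M₀ * K ^ 2 * I + 1, by positivity, fun l hl ρ₀ hρ h hh _ => ?_⟩
  have hρα : 0 < ρ₀ ^ α := Real.rpow_pos_of_pos hρ α
  set r : (Fin 2 → ℝ) → ℝ := fun z => √(z 0 ^ 2 + z 1 ^ 2) with hr
  have hr0 : ∀ z, 0 ≤ r z := fun z => Real.sqrt_nonneg _
  have hrm : Measurable r := by fun_prop
  set A : (Fin 2 → ℝ) → ℝ := fun z => M₀ / ρ₀ ^ α * r z ^ (1 + α) with hA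
  set c : (Fin 2 → ℝ) → ℝ := fun z => K ^ 2 * ((r z + h) ^ 4)⁻¹ with hc
  have hAm : Measurable A := by fun_prop
  have hcm : Measurable c := by fun_prop
  have hA0 : ∀ z, 0 ≤ A z := fun z =>
    mul_nonneg (by positivity) (Real.rpow_nonneg (hr0 z) _)
  set b : ℝ := 2 * M₀ * K ^ 2 / ρ₀ ^ α with hb
  have hAc : ∀ z, 2 * A z * c z ≤ b * (‖z‖ + h) ^ (-(3 - α)) := fun z => by
    have := rpow_mul_inv_pow_le (norm_nonneg z) (norm_le_sqrt_sq_add_sq z) hh hα0 hα1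
    calc 2 * A z * c z = b * (r z ^ (1 + α) * ((r z + h) ^ 4)⁻¹) := by
          simp only [hA, hc, hb]
          ring
      _ ≤ _ := by gcongr
  have hfin : (Module.finrank ℝ (Fin 2 → ℝ) : ℝ) < 3 - α := by
    rw [Module.finrank_fin_fun]
    push_cast
    linarith
  have hint : Integrable (fun z : Fin 2 → ℝ => b * (‖z‖ + h) ^ (-(3 - α))) :=
    (integrable_norm_add_rpow_neg volume hh hfin).const_mul b
  have hval : ∫ z : Fin 2 → ℝ, b * (‖z‖ + h) ^ (-(3 - α)) =
      2 * M₀ * K ^ 2 * I / h * (h / ρ₀) ^ α := by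
    rw [integral_const_mul, integral_norm_add_rpow_neg volume hh, Module.finrank_fin_fun,
      Real.div_rpow hh.le hρ.le, show ((2 : ℕ) : ℝ) - (3 - α) = α - 1 by push_cast; ring,
      Real.rpow_sub_one hh.ne']
    ring
  have hle : 2 * M₀ * K ^ 2 * I / h * (h / ρ₀) ^ α ≤
      (2 * M₀ * K ^ 2 * I + 1) / h * (h / ρ₀) ^ α := by
    gcongr
    linarith
  refine le_trans ?_ hle
  rw [← hval]
  refine (ENNReal.ofReal_le_ofReal_iff (integral_nonneg fun z => by positivity)).1 ?_
  rw [ofReal_integral_eq_lintegral_ofReal hint (ae_of_all _ fun z => by positivity)]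
  refine (Real.ofReal_le_enorm _).trans ((enorm_integral_le_lintegral_enorm _).trans ?_)
  set S : Set (ℝ × (Fin 2 → ℝ)) := {p | |p.1| ≤ A p.2}
  calc _ ≤ ∫⁻ x in lastCoordEquiv ⁻¹' S, ENNReal.ofReal (c (lastCoordEquiv x).2) := by
        refine (setLIntegral_mono (by fun_prop) ?_).trans
          (lintegral_mono_set (fun x hx => hx.2))
        rintro x ⟨hx1, hx2⟩
        have hxr : √(x 0 ^ 2 + x 1 ^ 2) ≤ ρ₀ := hx1.trans <| div_le_self hρ.le <|
          Real.one_le_sqrt.2 (by nlinarith [sq_nonneg M₀])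
        have hcone := hx2.trans
          (div_rpow_mul_rpow_one_add_le hM₀.le (Real.sqrt_nonneg _) hρ hxr hα0)
        have hinv : ∀ k, 2 / 3 * h ≤ k →
            (√(x 0 ^ 2 + x 1 ^ 2) ^ 2 + (x 2 + k) ^ 2)⁻¹ ≤
              K * ((√(x 0 ^ 2 + x 1 ^ 2) + h) ^ 2)⁻¹ := fun k hk => by
          have hpos : 0 < (√(x 0 ^ 2 + x 1 ^ 2) + h) ^ 2 := by positivity
          have hsq := sq_add_le_of_abs_le_mul hh hcone hk
          rw [← div_eq_mul_inv, le_div_iff₀ hpos, inv_mul_le_iff₀, mul_comm]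
          · exact hsq
          · exact pos_of_mul_pos_right (hpos.trans_le hsq) hK0.le
        rw [Real.enorm_of_nonneg (by positivity), norm_sub_neg_smul_single_sq,
          norm_sub_neg_smul_single_sq]
        refine ENNReal.ofReal_le_ofReal ?_
        calc _ ≤ (K * ((√(x 0 ^ 2 + x 1 ^ 2) + h) ^ 2)⁻¹) *
              (K * ((√(x 0 ^ 2 + x 1 ^ 2) + h) ^ 2)⁻¹) :=
            mul_le_mul (hinv h (by linarith)) (hinv (l * h) (by nlinarith [hl.1]))
              (by positivity) (by positivity)
          _ = c (lastCoordEquiv x).2 := by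
            simp only [hc, hr, lastCoordEquiv_snd_zero, lastCoordEquiv_snd_one]
            rw [mul_mul_mul_comm, ← mul_inv, ← pow_add, ← sq]
    _ = ∫⁻ p in S, ENNReal.ofReal (c p.2) :=
        measurePreserving_lastCoordEquiv.setLIntegral_comp_preimage_emb
          lastCoordEquiv.measurableEmbedding (fun p => ENNReal.ofReal (c p.2)) S
    _ = ∫⁻ z, ENNReal.ofReal (2 * A z * c z) := setLIntegral_abs_fst_le volume hAm hcm hA0
    _ ≤ _ := lintegral_mono fun z => ENNReal.ofReal_le_ofReal (hAc z)
end
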